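/- Write x_{ij} = x_i − x_j and q(x) = x₁₃x₂₄ + x₁₄x₂₃. On the open set U = {x ∈ ℝ⁴ : q(x) ≠ 0}, for every λ ∈ ℝ the vector fields X₁(λ) = (x₁₃x₂₄/q(x))(x₁−λ)∂₁ + (x₁₄x₂₃/q(x))(x₂−λ)∂₂ + (x₄−λ)∂₄ and X₂(λ) = (x₁₄x₂₃/q(x))(x₁−λ)∂₁ + (x₁₃x₂₄/q(x))(x₂−λ)∂₂ + (x₃−λ)∂₃ commute: [X₁(λ),X₂(λ)] = 0 on U. -/

import Mathlib

open scoped BigOperators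

/-- Partial derivative `∂f/∂x_j` on ℝ⁴ (coordinates `x₁,…,x₄` are indexed by `Fin 4`,
so `x_i` corresponds to index `i-1`). -/
noncomputable def pd (f : (Fin 4 → ℝ) → ℝ) (j : Fin 4) (x : Fin 4 → ℝ) : ℝ :=
  fderiv ℝ f x (Pi.single j 1)

/-- Lie bracket of vector fields on ℝ⁴:
`[X,Y]^i = ∑_j (X^j ∂_j Y^i − Y^j ∂_j X^i)`. -/
noncomputable def lieB (X Y : (Fin 4 → ℝ) → (Fin 4 → ℝ)) (x : Fin 4 → ℝ) : Fin 4 → ℝ :=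
  fun i => ∑ j, (X x j * pd (fun y => Y y i) j x - Y x j * pd (fun y => X y i) j x)

/-- `q(x) = x₁₃x₂₄ + x₁₄x₂₃` (with `x_{ij} = x_i − x_j`, 1-based indices
mapped to `Fin 4`). -/
def q (x : Fin 4 → ℝ) : ℝ :=
  (x 0 - x 2) * (x 1 - x 3) + (x 0 - x 3) * (x 1 - x 2)

theorem HasFDerivAt.pd_eq {f : (Fin 4 → ℝ) → ℝ} {f' : (Fin 4 → ℝ) →L[ℝ] ℝ} {x : Fin 4 → ℝ}
    (h : HasFDerivAt f f' x) (j : Fin 4) : pd f j x = f' (Pi.single j 1) := by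
  rw [pd, h.fderiv]

theorem pd_const (c : ℝ) (j : Fin 4) (x : Fin 4 → ℝ) : pd (fun _ => c) j x = 0 := by
  rw [(hasFDerivAt_const c x).pd_eq]
  rfl

theorem pd_coord_sub_const (i j : Fin 4) (c : ℝ) (x : Fin 4 → ℝ) :
    pd (fun y => y i - c) j x = Pi.single (M := fun _ => ℝ) j 1 i := by
  rw [((hasFDerivAt_apply i x).sub_const c).pd_eq]
  rfl

/-- The differential of `(yᵢ - yⱼ) (yₖ - yₗ)`, applied to `v`. -/
def dProd (i j k l : Fin 4) (x v : Fin 4 → ℝ) : ℝ :=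
  (x i - x j) * (v k - v l) + (x k - x l) * (v i - v j)

theorem pd_prod_div_q_mul (i j k l m r : Fin 4) (c : ℝ) {x : Fin 4 → ℝ} (hx : q x ≠ 0) :
    pd (fun y => (y i - y j) * (y k - y l) / q y * (y m - c)) r x =
      (x i - x j) * (x k - x l) / q x * Pi.single (M := fun _ => ℝ) r 1 m +
      (x m - c) * ((dProd i j k l x (Pi.single r 1) * q x - (x i - x j) * (x k - x l) *
        (dProd 0 2 1 3 x (Pi.single r 1) + dProd 0 3 1 2 x (Pi.single r 1))) / q x ^ 2) := by
  have hsub (a b : Fin 4) := (hasFDerivAt_apply (𝕜 := ℝ) (F' := fun _ => ℝ) a x).fun_sub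
    (hasFDerivAt_apply (𝕜 := ℝ) (F' := fun _ => ℝ) b x)
  have hq : HasFDerivAt q _ x := ((hsub 0 2).fun_mul (hsub 1 3)).fun_add
    ((hsub 0 3).fun_mul (hsub 1 2))
  have hinv : HasFDerivAt (fun y => (q y)⁻¹) _ x := (hasDerivAt_inv hx).comp_hasFDerivAt x hq
  simp only [div_eq_mul_inv]
  rw [((((hsub i j).fun_mul (hsub k l)).fun_mul hinv).fun_mul
    ((hasFDerivAt_apply m x).sub_const c)).pd_eq]
  simp [dProd]
  field_simp
  ring

/-- On `U = {x : q(x) ≠ 0}`, for every `λ ∈ ℝ` the vector fields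
`X₁(λ) = (x₁₃x₂₄/q)(x₁−λ)∂₁ + (x₁₄x₂₃/q)(x₂−λ)∂₂ + (x₄−λ)∂₄` and
`X₂(λ) = (x₁₄x₂₃/q)(x₁−λ)∂₁ + (x₁₃x₂₄/q)(x₂−λ)∂₂ + (x₃−λ)∂₃` commute. -/
theorem example_vector_fields_commute :
    ∀ lam : ℝ, ∀ x : Fin 4 → ℝ, q x ≠ 0 →
      lieB
        (fun y =>
          ![(y 0 - y 2) * (y 1 - y 3) / q y * (y 0 - lam),
            (y 0 - y 3) * (y 1 - y 2) / q y * (y 1 - lam),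
            0,
            y 3 - lam])
        (fun y =>
          ![(y 0 - y 3) * (y 1 - y 2) / q y * (y 0 - lam),
            (y 0 - y 2) * (y 1 - y 3) / q y * (y 1 - lam),
            y 2 - lam,
            0])
        x = 0 := by
  intro lam x hx
  have hx' := hx
  rw [q] at hx'
  ext i
  fin_cases i <;>
    simp [lieB, Fin.sum_univ_four, pd_prod_div_q_mul _ _ _ _ _ _ _ hx, pd_const,
      pd_coord_sub_const, dProd, Pi.single_apply] <;>
    simp only [q] <;> field_simp <;> ring
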